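/- arXiv:1907.00779 — 5 statements merged into one kernel-verified Lean document; each statement's English description precedes it below -/
import Mathlib

section
/- Assume G is connected, G[supp μ] is not connected, supp μ ≠ S, and N ≥ 3. Then for every integer k > k̄ and all indices l > m, one has 1 ≤ μ_k(s^m)/μ_k(s^l) ≤ k(N−1). -/
open Finset

attribute [local instance] Classical.propDecidable

/-- `k̄ = ⌈1 / min{μ(s) : s ∈ S, μ(s) > 0}⌉`. -/
noncomputable def suppMinCeil {N : ℕ} (μ : Fin N → ℝ) : ℕ :=
  ⌈1 / sInf (μ '' {s | 0 < μ s})⌉₊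

/-- `A_k = {s ∈ S : μ(s) < 1/k}`. -/
noncomputable def Ak {N : ℕ} (μ : Fin N → ℝ) (k : ℕ) : Finset (Fin N) :=
  Finset.univ.filter fun s => μ s < 1 / (k : ℝ)

/-- `η_k`, the uniform distribution on `A_k`. -/
noncomputable def etak {N : ℕ} (μ : Fin N → ℝ) (k : ℕ) : Fin N → ℝ :=
  fun s => if s ∈ Ak μ k then 1 / ((Ak μ k).card : ℝ) else 0

/-- `μ_k = (1/k) η_k + ((k-1)/k) μ`. -/
noncomputable def muk {N : ℕ} (μ : Fin N → ℝ) (k : ℕ) : Fin N → ℝ :=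
  fun s => (1 / (k : ℝ)) * etak μ k s + (((k : ℝ) - 1) / k) * μ s

/-- Every positive value of `μ` is at least `1 / (k - 1)` once `k` exceeds `k̄`. -/
theorem one_le_sub_one_mul_of_suppMinCeil_lt {N : ℕ} {μ : Fin N → ℝ} {k : ℕ}
    (hk : suppMinCeil μ < k) {s : Fin N} (hs : 0 < μ s) : 1 ≤ ((k : ℝ) - 1) * μ s := by
  have hfin : (μ '' {s | 0 < μ s}).Finite := Set.toFinite _
  have hmem : μ s ∈ μ '' {s | 0 < μ s} := ⟨s, hs, rfl⟩
  obtain ⟨t, ht, hts⟩ := Set.Nonempty.csInf_mem ⟨_, hmem⟩ hfin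
  have hpos : 0 < sInf (μ '' {s | 0 < μ s}) := hts ▸ ht
  have hle : sInf (μ '' {s | 0 < μ s}) ≤ μ s := csInf_le hfin.bddBelow hmem
  have hceil : 1 / sInf (μ '' {s | 0 < μ s}) ≤ (suppMinCeil μ : ℝ) := Nat.le_ceil _
  have hk' : (suppMinCeil μ : ℝ) + 1 ≤ k := by exact_mod_cast hk
  calc (1 : ℝ) ≤ 1 / sInf (μ '' {s | 0 < μ s}) * μ s := by
        rw [one_div_mul_eq_div, one_le_div hpos]
        exact hle
    _ ≤ ((k : ℝ) - 1) * μ s := mul_le_mul_of_nonneg_right (by linarith) hs.le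

theorem stmt_5 {N : ℕ} (hN : 3 ≤ N) (G : SimpleGraph (Fin N)) (hG : G.Connected)
    (μ : Fin N → ℝ) (hμ0 : ∀ s, 0 ≤ μ s) (hμ1 : ∑ s, μ s = 1)
    (hord : ∀ l m : Fin N, l ≤ m → μ m ≤ μ l)
    (hsupp : ¬ (G.induce {s : Fin N | 0 < μ s}).Connected)
    (hne : {s : Fin N | 0 < μ s} ≠ Set.univ)
    (k : ℕ) (hk : suppMinCeil μ < k) :
    ∀ l m : Fin N, m < l →
      1 ≤ muk μ k m / muk μ k l ∧ muk μ k m / muk μ k l ≤ (k : ℝ) * ((N : ℝ) - 1) := by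
  intro l m hml
  obtain ⟨s, hs⟩ : ∃ s, 0 < μ s := by
    by_contra! h
    linarith [Finset.sum_nonpos fun s (_ : s ∈ Finset.univ) => h s]
  have hle1 : ∀ s, μ s ≤ 1 := fun s =>
    hμ1 ▸ Finset.single_le_sum (fun i _ => hμ0 i) (Finset.mem_univ s)
  have hlow := fun {s} => one_le_sub_one_mul_of_suppMinCeil_lt (s := s) hk
  have hk2 : (2 : ℝ) ≤ k := by nlinarith [hlow hs, hle1 s]
  have hk0 : (0 : ℝ) < k := by linarith
  have hN' : (3 : ℝ) ≤ N := by exact_mod_cast hN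
  have hA : ∀ s, s ∈ Ak μ k ↔ μ s = 0 := by
    intro s
    simp only [Ak, Finset.mem_filter, Finset.mem_univ, true_and, lt_div_iff₀ hk0]
    refine ⟨fun h => ?_, fun h => by simp [h]⟩
    by_contra h0
    have hs := lt_of_le_of_ne (hμ0 s) (Ne.symm h0)
    nlinarith [hlow hs]
  have hcardN : ((Ak μ k).card : ℝ) ≤ N - 1 := by
    have h : (Ak μ k).card < N := by
      simpa using Finset.card_lt_univ_of_notMem (x := s) (by rw [hA]; exact hs.ne')
    have h' : ((Ak μ k).card : ℝ) + 1 ≤ N := by exact_mod_cast h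
    linarith
  have hcard0 : (0 : ℝ) < (Ak μ k).card := by
    obtain ⟨t, ht⟩ := (Set.ne_univ_iff_exists_notMem _).1 hne
    have ht0 : μ t = 0 := le_antisymm (not_lt.1 ht) (hμ0 t)
    exact_mod_cast Finset.card_pos.2 ⟨t, (hA t).2 ht0⟩
  have hzero : ∀ s, μ s = 0 → muk μ k s = 1 / ((k : ℝ) * (Ak μ k).card) := by
    intro s h
    simp only [muk, etak, hA, h, if_true, mul_zero, add_zero]
    field_simp
  have hposv : ∀ s, 0 < μ s → muk μ k s = ((k : ℝ) - 1) / k * μ s := by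
    intro s h
    simp [muk, etak, hA, h.ne']
  have hmon := hord m l hml.le
  rcases (hμ0 l).eq_or_lt with hl | hl
  · rcases (hμ0 m).eq_or_lt with hm | hm
    · rw [hzero m hm.symm, hzero l hl.symm, div_self (by positivity)]
      exact ⟨le_rfl, by nlinarith⟩
    · have hratio : muk μ k m / muk μ k l = ((k : ℝ) - 1) * μ m * (Ak μ k).card := by
        rw [hposv m hm, hzero l hl.symm]
        field_simp
      have hcard1 : (1 : ℝ) ≤ (Ak μ k).card := by
        exact_mod_cast Nat.one_le_iff_ne_zero.2 (by exact_mod_cast hcard0.ne')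
      rw [hratio]
      refine ⟨one_le_mul_of_one_le_of_one_le (hlow hm) hcard1, ?_⟩
      exact mul_le_mul (by nlinarith [hle1 m]) hcardN hcard0.le hk0.le
  · have hm : 0 < μ m := hl.trans_le hmon
    have hk1 : (0 : ℝ) < k - 1 := by linarith
    have hratio : muk μ k m / muk μ k l = μ m / μ l := by
      rw [hposv m hm, hposv l hl]
      exact mul_div_mul_left _ _ (by positivity)
    rw [hratio, one_le_div hl, div_le_iff₀ hl]
    refine ⟨hmon, ?_⟩
    have hkl : 1 ≤ (k : ℝ) * μ l := by linarith [hlow hl]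
    nlinarith [hle1 m]
end

section
/- Let G = (S, E) be a connected finite simple graph with N = |S| ≥ 2 vertices labeled s^1, …, s^N, let P be an N×N stochastic matrix, and let 0 < α ≤ 1/2. Assume P_{l,l} ≥ 1/2 for every l, and P_{l,m} ≥ α whenever l ≠ m and {s^l, s^m} ∈ E. Then every entry of the matrix power P^{N−1} is at least α^{N−1}. -/
open Finset

/-- If all entries of a nonnegative matrix on the diagonal and on the edges of a graph are at
least `α`, then a walk of length at most `k` forces the matching entry of `P ^ k` to be at least
`α ^ k`. -/
theorem SimpleGraph.Walk.pow_le_matrix_pow_apply {V : Type*} [Fintype V] [DecidableEq V]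
    {G : SimpleGraph V} {P : Matrix V V ℝ} (hP : ∀ l m, 0 ≤ P l m) {α : ℝ} (hα : 0 ≤ α)
    (hdiag : ∀ l, α ≤ P l l) (hadj : ∀ l m, G.Adj l m → α ≤ P l m)
    {l m : V} (w : G.Walk l m) {k : ℕ} (hk : w.length ≤ k) :
    α ^ k ≤ (P ^ k) l m := by
  have pow_nonneg_apply (k : ℕ) (i j : V) : 0 ≤ (P ^ k) i j := by
    induction k generalizing i with
    | zero => rw [pow_zero, Matrix.one_apply]; split_ifs <;> norm_num
    | succ k ih =>
      rw [pow_succ', Matrix.mul_apply]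
      exact sum_nonneg fun x _ => mul_nonneg (hP i x) (ih x)
  have step {k : ℕ} {i x j : V} (hx : α ≤ P i x) (h : α ^ k ≤ (P ^ k) x j) :
      α ^ (k + 1) ≤ (P ^ (k + 1)) i j := by
    rw [pow_succ', pow_succ', Matrix.mul_apply]
    calc α * α ^ k ≤ P i x * (P ^ k) x j := by gcongr; exact hP i x
      _ ≤ ∑ y, P i y * (P ^ k) y j :=
        single_le_sum (f := fun y => P i y * (P ^ k) y j)
          (fun y _ => mul_nonneg (hP i y) (pow_nonneg_apply k y j)) (mem_univ x)
  induction w generalizing k with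
  | nil =>
    clear hk
    induction k with
    | zero => simp
    | succ k ih => exact step (hdiag _) ih
  | cons h w ih =>
    cases k with
    | zero => simp at hk
    | succ k => exact step (hadj _ _ h) (ih (by simpa using hk))

theorem stmt_7 {N : ℕ} (hN : 2 ≤ N) (G : SimpleGraph (Fin N)) (hG : G.Connected)
    (P : Matrix (Fin N) (Fin N) ℝ)
    (hP0 : ∀ l m, 0 ≤ P l m) (hP1 : ∀ l, ∑ m, P l m = 1)
    (α : ℝ) (hα0 : 0 < α) (hα : α ≤ 1 / 2)
    (hdiag : ∀ l, 1 / 2 ≤ P l l)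
    (hadj : ∀ l m : Fin N, l ≠ m → G.Adj l m → α ≤ P l m) :
    ∀ l m : Fin N, α ^ (N - 1) ≤ (P ^ (N - 1)) l m := by
  intro l m
  obtain ⟨w, hw⟩ := hG.exists_isPath l m
  have hlen := hw.length_lt
  rw [Fintype.card_fin] at hlen
  exact w.pow_le_matrix_pow_apply hP0 hα0.le (fun i => hα.trans (hdiag i))
    (fun i j h => hadj i j h.ne h) (by omega)
end

section
/- Assume G is connected, G[supp μ] is not connected, supp μ ≠ S, and N ≥ 3, and let c_N = 1/(2(N−1)^2). Then for every integer k > k̄, the Dobrushin ergodic coefficient satisfies δ((P^{(μ_k,G)})^{N−1}) ≤ 1 − (c_N/k)^{N−1}. -/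
open Finset

attribute [local instance] Classical.propDecidable

/-- The denominator appearing in the definition of the constant `p`:
`Σ_{m>l} 1_{{s^l,s^m} ∈ E} + Σ_{m<l} (ν(s^m)/ν(s^l)) 1_{{s^l,s^m} ∈ E}`. -/
noncomputable def denomP {V : Type*} [Fintype V] [LinearOrder V]
    (G : SimpleGraph V) (ν : V → ℝ) (l : V) : ℝ :=
  (∑ m, if l < m ∧ G.Adj l m then (1 : ℝ) else 0)
    + ∑ m, if m < l ∧ G.Adj l m then ν m / ν l else 0

/-- The constant `p = min_l 1/(2 · denom(l))`. -/
noncomputable def pconst {V : Type*} [Fintype V] [LinearOrder V]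
    (G : SimpleGraph V) (ν : V → ℝ) : ℝ :=
  ⨅ l, 1 / (2 * denomP G ν l)

/-- The transition matrix `P^{(ν,G)}`. -/
noncomputable def Pmat {V : Type*} [Fintype V] [LinearOrder V]
    (G : SimpleGraph V) (ν : V → ℝ) : Matrix V V ℝ :=
  Matrix.of fun l m =>
    if l = m then 1 - pconst G ν * denomP G ν l
    else if l < m ∧ G.Adj l m then pconst G ν
    else if m < l ∧ G.Adj l m then (ν m / ν l) * pconst G ν
    else 0

/-- The Dobrushin ergodic coefficient
`δ(P) = 1 - min_{i,j} Σ_h min(p_{i,h}, p_{j,h})`. -/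
noncomputable def dobrushin {N : ℕ} (P : Matrix (Fin N) (Fin N) ℝ) : ℝ :=
  1 - ⨅ q : Fin N × Fin N, ∑ h, min (P q.1 h) (P q.2 h)

/-- If every diagonal entry and every entry along an edge of `G` of a nonnegative matrix is at
least `ε`, then so is, up to the power `n`, every entry of its `n`-th power joined by a walk of
length at most `n`. -/
lemma pow_le_matrix_pow_apply_of_walk {V : Type*} [Fintype V] [DecidableEq V] (G : SimpleGraph V)
    (P : Matrix V V ℝ) (hP : ∀ i j, 0 ≤ P i j) {ε : ℝ} (hε : 0 ≤ ε) (hdiag : ∀ i, ε ≤ P i i)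
    (hadj : ∀ i j, G.Adj i j → ε ≤ P i j) (n : ℕ) :
    ∀ {i j : V} (w : G.Walk i j), w.length ≤ n → ε ^ n ≤ (P ^ n) i j := by
  have hpow : ∀ n i j, 0 ≤ (P ^ n) i j := by
    intro n
    induction n with
    | zero =>
      intro i j
      rw [pow_zero, Matrix.one_apply]
      split_ifs <;> norm_num
    | succ n ih =>
      intro i j
      rw [pow_succ', Matrix.mul_apply]
      exact Finset.sum_nonneg fun v _ => mul_nonneg (hP _ _) (ih _ _)
  have hstep : ∀ n i v j, P i v * (P ^ n) v j ≤ (P ^ (n + 1)) i j := by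
    intro n i v j
    rw [pow_succ', Matrix.mul_apply]
    exact Finset.single_le_sum (f := fun v => P i v * (P ^ n) v j)
      (fun v _ => mul_nonneg (hP _ _) (hpow _ _ _)) (Finset.mem_univ v)
  induction n with
  | zero =>
    intro i j w hw
    obtain rfl := SimpleGraph.Walk.eq_of_length_eq_zero (Nat.le_zero.mp hw)
    simp
  | succ n ih =>
    intro i j w hw
    rw [pow_succ']
    cases w with
    | nil =>
      exact (mul_le_mul (hdiag i) (ih (SimpleGraph.Walk.nil' i) (by simp)) (by positivity)
        (hP _ _)).trans (hstep n i i i)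
    | @cons _ v _ h w =>
      rw [SimpleGraph.Walk.length_cons] at hw
      exact (mul_le_mul (hadj i v h) (ih w (by lia)) (by positivity)
        (hP _ _)).trans (hstep n i v j)

/-- In a connected graph on `N` vertices, all entries of the `(N - 1)`-st power of such a matrix
are at least `ε ^ (N - 1)`. -/
lemma pow_le_matrix_pow_apply_of_connected {V : Type*} [Fintype V] [DecidableEq V]
    {G : SimpleGraph V} (hG : G.Connected) (P : Matrix V V ℝ) (hP : ∀ i j, 0 ≤ P i j) {ε : ℝ}
    (hε : 0 ≤ ε) (hdiag : ∀ i, ε ≤ P i i) (hadj : ∀ i j, G.Adj i j → ε ≤ P i j) (i j : V) :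
    ε ^ (Fintype.card V - 1) ≤ (P ^ (Fintype.card V - 1)) i j := by
  obtain ⟨w, hw⟩ := (hG i j).exists_isPath
  exact pow_le_matrix_pow_apply_of_walk G P hP hε hdiag hadj _ w
    (Nat.le_sub_one_of_lt hw.length_lt)

lemma dobrushin_le_one_sub {N : ℕ} (hN : 0 < N) (P : Matrix (Fin N) (Fin N) ℝ) {a : ℝ}
    (ha : 0 ≤ a) (hP : ∀ i j, a ≤ P i j) : dobrushin P ≤ 1 - a := by
  have : Nonempty (Fin N) := ⟨⟨0, hN⟩⟩
  refine sub_le_sub_left (le_ciInf fun q => ?_) 1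
  have h0 : ∀ h, a ≤ min (P q.1 h) (P q.2 h) := fun h => le_min (hP _ _) (hP _ _)
  exact (h0 ⟨0, hN⟩).trans (Finset.single_le_sum (f := fun h => min (P q.1 h) (P q.2 h))
    (fun h _ => ha.trans (h0 h)) (Finset.mem_univ _))

section TransitionMatrix

variable {V : Type*} [Fintype V] [LinearOrder V] {G : SimpleGraph V} {ν : V → ℝ}

lemma denomP_pos [Nontrivial V] (hG : G.Connected) (hν : ∀ s, 0 < ν s) (l : V) :
    0 < denomP G ν l := by
  obtain ⟨m, hm⟩ := hG.preconnected.exists_adj_of_nontrivial l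
  have h1 : ∀ m, 0 ≤ if l < m ∧ G.Adj l m then (1 : ℝ) else 0 := fun m => by
    split_ifs <;> norm_num
  have h2 : ∀ m, 0 ≤ if m < l ∧ G.Adj l m then ν m / ν l else 0 := fun m => by
    split_ifs
    exacts [(div_pos (hν _) (hν _)).le, le_rfl]
  rw [denomP]
  rcases lt_or_gt_of_ne hm.ne with h | h
  · refine add_pos_of_pos_of_nonneg ?_ (Finset.sum_nonneg fun m _ => h2 m)
    exact Finset.sum_pos' (fun m _ => h1 m) ⟨m, Finset.mem_univ _, by simp [h, hm]⟩
  · refine add_pos_of_nonneg_of_pos (Finset.sum_nonneg fun m _ => h1 m) ?_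
    exact Finset.sum_pos' (fun m _ => h2 m)
      ⟨m, Finset.mem_univ _, by simpa [h, hm] using div_pos (hν _) (hν _)⟩

lemma denomP_le {K : ℝ} (hK : 1 ≤ K) (hν : ∀ s, 1 / K ≤ ν s) (hν1 : ∀ s, ν s ≤ 1) (l : V) :
    denomP G ν l ≤ ((Fintype.card V : ℝ) - 1) * K := by
  have hK0 : 0 < K := by linarith
  have hsum : ∑ m, (if m = l then 0 else K) = ((Fintype.card V : ℝ) - 1) * K := by
    have : ∀ m : V, (if m = l then 0 else K) = K - if m = l then K else 0 := fun m => by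
      split_ifs <;> ring
    simp only [this, Finset.sum_sub_distrib, Finset.sum_ite_eq', Finset.mem_univ, if_true,
      Finset.sum_const, Finset.card_univ, nsmul_eq_mul]
    ring
  rw [denomP, ← Finset.sum_add_distrib, ← hsum]
  refine Finset.sum_le_sum fun m _ => ?_
  have hratio : ν m / ν l ≤ K := by
    have hl : 0 < ν l := (one_div_pos.mpr hK0).trans_le (hν l)
    rw [div_le_iff₀ hl]
    have := (div_le_iff₀' hK0).mp (hν l)
    linarith [hν1 m]
  rcases lt_trichotomy l m with h | h | h
  · rw [if_neg (fun h' : m < l ∧ G.Adj l m => h.not_gt h'.1), if_neg h.ne', add_zero]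
    split_ifs <;> linarith
  · simp [h]
  · rw [if_neg (fun h' : l < m ∧ G.Adj l m => h.not_gt h'.1), if_neg h.ne, zero_add]
    split_ifs <;> linarith

lemma le_pconst [Nontrivial V] (hG : G.Connected) {K : ℝ} (hK : 1 ≤ K) (hν : ∀ s, 1 / K ≤ ν s)
    (hν1 : ∀ s, ν s ≤ 1) : 1 / (2 * (((Fintype.card V : ℝ) - 1) * K)) ≤ pconst G ν := by
  have hpos : ∀ s, 0 < ν s := fun s => (by positivity : 0 < 1 / K).trans_le (hν s)
  refine le_ciInf fun l => one_div_le_one_div_of_le ?_ ?_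
  · exact mul_pos two_pos (denomP_pos hG hpos l)
  · linarith [denomP_le (G := G) hK hν hν1 l]

lemma pconst_mul_denomP_le [Nontrivial V] (hG : G.Connected) (hν : ∀ s, 0 < ν s) (l : V) :
    pconst G ν * denomP G ν l ≤ 1 / 2 := by
  have h : pconst G ν ≤ 1 / (2 * denomP G ν l) := ciInf_le (Set.finite_range _).bddBelow l
  have hd := denomP_pos hG hν l
  calc pconst G ν * denomP G ν l ≤ 1 / (2 * denomP G ν l) * denomP G ν l := by gcongr
    _ = 1 / 2 := by field_simp

lemma half_le_Pmat_diag [Nontrivial V] (hG : G.Connected) (hν : ∀ s, 0 < ν s) (l : V) :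
    1 / 2 ≤ Pmat G ν l l := by
  have := pconst_mul_denomP_le hG hν l
  simp only [Pmat, Matrix.of_apply, if_true]
  linarith

lemma Pmat_nonneg [Nontrivial V] (hG : G.Connected) (hν : ∀ s, 0 < ν s)
    (hp : 0 ≤ pconst G ν) (l m : V) : 0 ≤ Pmat G ν l m := by
  by_cases h : l = m
  · subst h
    linarith [half_le_Pmat_diag hG hν l]
  · simp only [Pmat, Matrix.of_apply, if_neg h]
    split_ifs
    exacts [hp, mul_nonneg (div_pos (hν _) (hν _)).le hp, le_rfl]

lemma pconst_le_Pmat_of_adj (hν : ∀ s, 0 < ν s) (hanti : Antitone ν) (hp : 0 ≤ pconst G ν)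
    {l m : V} (h : G.Adj l m) : pconst G ν ≤ Pmat G ν l m := by
  simp only [Pmat, Matrix.of_apply, if_neg h.ne]
  rcases lt_or_gt_of_ne h.ne with hlt | hlt
  · rw [if_pos ⟨hlt, h⟩]
  · rw [if_neg (fun h' => hlt.not_gt h'.1), if_pos ⟨hlt, h⟩]
    exact le_mul_of_one_le_left hp ((one_le_div (hν l)).mpr (hanti hlt.le))

end TransitionMatrix

section PerturbedDistribution

variable {N : ℕ} {μ : Fin N → ℝ} {k : ℕ}

lemma sInf_image_pos_of_pos {s : Fin N} (hs : 0 < μ s) : 0 < sInf (μ '' {s | 0 < μ s}) := by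
  have hmem : sInf (μ '' {s | 0 < μ s}) ∈ μ '' {s | 0 < μ s} :=
    Set.Nonempty.csInf_mem ⟨μ s, s, hs, rfl⟩ (Set.toFinite _)
  obtain ⟨t, ht, hteq⟩ := hmem
  rw [← hteq]
  exact ht

lemma two_le_of_suppMinCeil_lt {s : Fin N} (hs : 0 < μ s) (hk : suppMinCeil μ < k) : 2 ≤ k := by
  have : 0 < suppMinCeil μ := Nat.ceil_pos.mpr (one_div_pos.mpr (sInf_image_pos_of_pos hs))
  lia

lemma one_le_sub_one_mul_of_pos {s : Fin N} (hs : 0 < μ s) (hk : suppMinCeil μ < k) :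
    1 ≤ ((k : ℝ) - 1) * μ s := by
  have h0 := sInf_image_pos_of_pos hs
  have hle : sInf (μ '' {s | 0 < μ s}) ≤ μ s :=
    csInf_le (Set.toFinite _).bddBelow ⟨s, hs, rfl⟩
  have h1 : 1 / sInf (μ '' {s | 0 < μ s}) ≤ (k : ℝ) - 1 := by
    have h2 : ((suppMinCeil μ : ℕ) : ℝ) + 1 ≤ k := by exact_mod_cast hk
    have h3 : 1 / sInf (μ '' {s | 0 < μ s}) ≤ ((suppMinCeil μ : ℕ) : ℝ) := Nat.le_ceil _
    linarith
  rw [div_le_iff₀ h0] at h1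
  have h4 : (0 : ℝ) ≤ (k : ℝ) - 1 := by
    have := two_le_of_suppMinCeil_lt hs hk
    have : (2 : ℝ) ≤ k := by exact_mod_cast this
    linarith
  exact h1.trans (by gcongr)

lemma notMem_Ak_of_pos {s : Fin N} (hs : 0 < μ s) (hk : suppMinCeil μ < k) : s ∉ Ak μ k := by
  have hk0 : (0 : ℝ) < k := by exact_mod_cast Nat.zero_lt_of_lt hk
  simp only [Ak, Finset.mem_filter, Finset.mem_univ, true_and, not_lt]
  rw [div_le_iff₀ hk0]
  linarith [one_le_sub_one_mul_of_pos hs hk]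

lemma muk_of_pos {s : Fin N} (hs : 0 < μ s) (hk : suppMinCeil μ < k) :
    muk μ k s = ((k : ℝ) - 1) / k * μ s := by
  simp [muk, etak, notMem_Ak_of_pos hs hk]

lemma one_div_le_muk_of_pos {s : Fin N} (hs : 0 < μ s) (hk : suppMinCeil μ < k) :
    1 / (k : ℝ) ≤ muk μ k s := by
  rw [muk_of_pos hs hk, div_mul_eq_mul_div]
  gcongr
  exact one_le_sub_one_mul_of_pos hs hk

lemma mem_Ak_of_eq_zero {s : Fin N} (hs : μ s = 0) (hk : 0 < k) : s ∈ Ak μ k := by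
  simp [Ak, hs, hk]

lemma muk_of_eq_zero {s : Fin N} (hs : μ s = 0) (hk : 0 < k) :
    muk μ k s = 1 / (k : ℝ) * (1 / ((Ak μ k).card : ℝ)) := by
  simp [muk, etak, hs, mem_Ak_of_eq_zero hs hk]

lemma muk_le_one_div_of_eq_zero {s : Fin N} (hs : μ s = 0) (hk : 0 < k) :
    muk μ k s ≤ 1 / (k : ℝ) := by
  rw [muk_of_eq_zero hs hk]
  have hcard : (1 : ℝ) ≤ (Ak μ k).card := by
    exact_mod_cast Finset.card_pos.mpr ⟨s, mem_Ak_of_eq_zero hs hk⟩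
  exact mul_le_of_le_one_right (by positivity) ((div_le_one (by linarith)).mpr hcard)

lemma antitone_muk (hμ0 : ∀ s, 0 ≤ μ s) (hμ : Antitone μ) (hk : suppMinCeil μ < k) :
    Antitone (muk μ k) := by
  intro l m hlm
  have hk0 := Nat.zero_lt_of_lt hk
  rcases (hμ0 m).eq_or_lt' with hm | hm
  · rcases (hμ0 l).eq_or_lt' with hl | hl
    · rw [muk_of_eq_zero hm hk0, muk_of_eq_zero hl hk0]
    · exact (muk_le_one_div_of_eq_zero hm hk0).trans (one_div_le_muk_of_pos hl hk)
  · rw [muk_of_pos hm hk, muk_of_pos (hm.trans_le (hμ hlm)) hk]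
    have : (1 : ℝ) ≤ k := by exact_mod_cast hk0
    exact mul_le_mul_of_nonneg_left (hμ hlm) (div_nonneg (by linarith) (by linarith))

lemma muk_le_one (hμ0 : ∀ s, 0 ≤ μ s) (hμ1 : ∑ s, μ s = 1) (hk : suppMinCeil μ < k)
    (s : Fin N) : muk μ k s ≤ 1 := by
  have hk0 := Nat.zero_lt_of_lt hk
  have hk1 : (1 : ℝ) ≤ k := by exact_mod_cast hk0
  rcases (hμ0 s).eq_or_lt' with hs | hs
  · exact (muk_le_one_div_of_eq_zero hs hk0).trans ((div_le_one (by linarith)).mpr hk1)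
  · rw [muk_of_pos hs hk]
    have h1 : μ s ≤ 1 :=
      hμ1 ▸ Finset.single_le_sum (f := μ) (fun t _ => hμ0 t) (Finset.mem_univ s)
    exact mul_le_one₀ ((div_le_one (by linarith)).mpr (by linarith)) (hμ0 s) h1

lemma one_div_le_muk (hN : 2 ≤ N) (hμ0 : ∀ s, 0 ≤ μ s) (hμ1 : ∑ s, μ s = 1)
    (hk : suppMinCeil μ < k) (s : Fin N) : 1 / ((k : ℝ) * ((N : ℝ) - 1)) ≤ muk μ k s := by
  have hk0 := Nat.zero_lt_of_lt hk
  have hk1 : (1 : ℝ) ≤ k := by exact_mod_cast hk0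
  have hN2 : (2 : ℝ) ≤ N := by exact_mod_cast hN
  rcases (hμ0 s).eq_or_lt' with hs | hs
  · obtain ⟨t, -, ht⟩ : ∃ t ∈ Finset.univ, 0 < μ t :=
      Finset.exists_lt_of_sum_lt (f := fun _ => 0) (by simp [hμ1])
    have hlt : (Ak μ k).card < N := by
      simpa using Finset.card_lt_univ_of_notMem (notMem_Ak_of_pos ht hk)
    have hlt' : ((Ak μ k).card : ℝ) ≤ (N : ℝ) - 1 := by
      have : ((Ak μ k).card : ℝ) + 1 ≤ N := by exact_mod_cast hlt
      linarith
    have hcard : (0 : ℝ) < (Ak μ k).card := by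
      exact_mod_cast Finset.card_pos.mpr ⟨s, mem_Ak_of_eq_zero hs hk0⟩
    rw [muk_of_eq_zero hs hk0, one_div_mul_one_div]
    gcongr
  · refine le_trans ?_ (one_div_le_muk_of_pos hs hk)
    exact one_div_le_one_div_of_le (by linarith)
      (le_mul_of_one_le_right (by linarith) (by linarith))

end PerturbedDistribution

theorem stmt_8 {N : ℕ} (hN : 3 ≤ N) (G : SimpleGraph (Fin N)) (hG : G.Connected)
    (μ : Fin N → ℝ) (hμ0 : ∀ s, 0 ≤ μ s) (hμ1 : ∑ s, μ s = 1)
    (hord : ∀ l m : Fin N, l ≤ m → μ m ≤ μ l)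
    (hsupp : ¬ (G.induce {s : Fin N | 0 < μ s}).Connected)
    (hne : {s : Fin N | 0 < μ s} ≠ Set.univ)
    (cN : ℝ) (hcN : cN = 1 / (2 * ((N : ℝ) - 1) ^ 2))
    (k : ℕ) (hk : suppMinCeil μ < k) :
    dobrushin ((Pmat G (muk μ k)) ^ (N - 1)) ≤ 1 - (cN / k) ^ (N - 1) := by
  have hN3 : (3 : ℝ) ≤ N := by exact_mod_cast hN
  have hk1 : (1 : ℝ) ≤ k := by exact_mod_cast Nat.zero_lt_of_lt hk
  have : Nontrivial (Fin N) := Fin.nontrivial_iff_two_le.mpr (by lia)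
  have hK : (1 : ℝ) ≤ (k : ℝ) * ((N : ℝ) - 1) := by nlinarith
  have hlow := one_div_le_muk (by lia) hμ0 hμ1 hk
  have hpos : ∀ s, 0 < muk μ k s := fun s => (by positivity :
    0 < 1 / ((k : ℝ) * ((N : ℝ) - 1))).trans_le (hlow s)
  have hε : 0 ≤ cN / k := by rw [hcN]; positivity
  have hεp : cN / k ≤ pconst G (muk μ k) := by
    refine le_of_eq_of_le ?_ (le_pconst hG hK hlow (muk_le_one hμ0 hμ1 hk))
    rw [hcN, Fintype.card_fin, div_div]
    ring
  have hp := hε.trans hεp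
  have hεhalf : cN / k ≤ 1 / 2 := by
    rw [hcN, div_div]
    refine one_div_le_one_div_of_le two_pos ?_
    nlinarith [mul_le_mul hK (by linarith : (1 : ℝ) ≤ (N : ℝ) - 1) zero_le_one (by linarith)]
  refine dobrushin_le_one_sub (by lia) _ (pow_nonneg hε _) fun i j => ?_
  simpa only [Fintype.card_fin] using pow_le_matrix_pow_apply_of_connected hG
    (Pmat G (muk μ k)) (Pmat_nonneg hG hpos hp) hε
    (fun i => hεhalf.trans (half_le_Pmat_diag hG hpos i))
    (fun i j h => hεp.trans (pconst_le_Pmat_of_adj hpos (antitone_muk hμ0 hord hk) hp h)) i j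
end

section
/- Let μ be a probability distribution on S such that G[supp μ] is not connected and supp μ is not contained in a single connected component of G (i.e. there exist s', s'' ∈ supp μ belonging to two different connected components of G). Then there exists no stochastic process X = (X(t) : t ∈ ℕ) with values in S that is consistent with G and satisfies, for every s ∈ S, lim_{t→∞} (1/t) Σ_{m=0}^{t−1} 1_{{X(m)=s}} = μ(s) almost surely. -/
open Finset Filter MeasureTheory

attribute [local instance] Classical.propDecidable

/-- `X = (X(t) : t ∈ ℕ)` is a (possibly non-homogeneous) Markov chain with one-step
transition matrix `T t` at time `t` (and arbitrary initial distribution, namely the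
law of `X 0`): the finite-dimensional distributions factorize as
`P(X_0 = x_0, …, X_{n+1} = x_{n+1}) = P(X_0 = x_0) ∏_{i=0}^{n} T i (x_i, x_{i+1})`. -/
def IsMarkovOn {Ω S : Type*} [MeasurableSpace Ω] (P : MeasureTheory.Measure Ω)
    (X : ℕ → Ω → S) (T : ℕ → Matrix S S ℝ) : Prop :=
  ∀ (n : ℕ) (path : ℕ → S),
    (P {ω | ∀ i ≤ n + 1, X i ω = path i}).toReal
      = (P {ω | X 0 ω = path 0}).toReal
        * ∏ i ∈ Finset.range (n + 1), T i (path i) (path (i + 1))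

/-- The process `X` is consistent with the graph `G`: with probability one,
`X(t)` and `X(t+1)` are adjacent in `G` (i.e. equal or joined by an edge). -/
def ConsistentWith {Ω V : Type*} [MeasurableSpace Ω] (P : MeasureTheory.Measure Ω)
    (X : ℕ → Ω → V) (G : SimpleGraph V) : Prop :=
  ∀ t : ℕ, P {ω | X t ω = X (t + 1) ω ∨ G.Adj (X t ω) (X (t + 1) ω)} = 1

/-- A process consistent with `G` almost surely moves to an adjacent state at every time. -/
theorem ConsistentWith.ae_forall {Ω V : Type*} [MeasurableSpace Ω] [MeasurableSpace V]
    [Countable V] [MeasurableSingletonClass V] {P : Measure Ω} [IsProbabilityMeasure P]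
    {X : ℕ → Ω → V} {G : SimpleGraph V} (hX : ∀ t, Measurable (X t))
    (h : ConsistentWith P X G) :
    ∀ᵐ ω ∂P, ∀ t, X t ω = X (t + 1) ω ∨ G.Adj (X t ω) (X (t + 1) ω) := by
  refine ae_all_iff.2 fun t ↦ ?_
  have hmeas : MeasurableSet {ω | X t ω = X (t + 1) ω ∨ G.Adj (X t ω) (X (t + 1) ω)} :=
    ((hX t).prodMk (hX (t + 1)))
      (Set.to_countable {p : V × V | p.1 = p.2 ∨ G.Adj p.1 p.2}).measurableSet
  exact (mem_ae_iff_prob_eq_one hmeas).2 (h t)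

/-- Any two states visited by a trajectory moving between adjacent states are reachable
from each other. -/
theorem SimpleGraph.reachable_of_forall_eq_or_adj {V : Type*} {G : SimpleGraph V} {x : ℕ → V}
    (h : ∀ t, x t = x (t + 1) ∨ G.Adj (x t) (x (t + 1))) (m n : ℕ) :
    G.Reachable (x m) (x n) := by
  have key (n : ℕ) : G.Reachable (x 0) (x n) := by
    induction n with
    | zero => exact .rfl
    | succ n ih =>
      rcases h n with h | h
      · exact h ▸ ih
      · exact ih.trans h.reachable
  exact (key m).symm.trans (key n)

/-- A state whose asymptotic frequency is nonzero is visited. -/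
theorem exists_eq_of_tendsto_frequency {V : Type*} {x : ℕ → V} {s : V}
    [∀ m, Decidable (x m = s)] {a : ℝ} (ha : a ≠ 0)
    (h : Tendsto (fun t : ℕ => (∑ m ∈ Finset.range t, if x m = s then (1 : ℝ) else 0) / t)
      atTop (nhds a)) : ∃ m, x m = s := by
  by_contra! hne
  simp only [hne, if_false, Finset.sum_const_zero, zero_div] at h
  exact ha (tendsto_nhds_unique h tendsto_const_nhds)

theorem stmt_13 {N : ℕ} (G : SimpleGraph (Fin N))
    (μ : Fin N → ℝ) (hμ0 : ∀ s, 0 ≤ μ s) (hμ1 : ∑ s, μ s = 1)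
    (hsupp : ¬ (G.induce {s : Fin N | 0 < μ s}).Connected)
    (hsplit : ∃ s' s'' : Fin N, 0 < μ s' ∧ 0 < μ s'' ∧ ¬ G.Reachable s' s'')
    {Ω : Type*} [MeasurableSpace Ω] (P : Measure Ω) [IsProbabilityMeasure P]
    (X : ℕ → Ω → Fin N) (hX : ∀ t, Measurable (X t))
    (hcons : ConsistentWith P X G) :
    ¬ ∀ s : Fin N, ∀ᵐ ω ∂P,
      Tendsto (fun t : ℕ => (∑ m ∈ Finset.range t, if X m ω = s then (1 : ℝ) else 0) / t)
        atTop (nhds (μ s)) := by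
  intro h
  obtain ⟨s', s'', hs', hs'', hreach⟩ := hsplit
  obtain ⟨ω, hω, h', h''⟩ := ((hcons.ae_forall hX).and ((h s').and (h s''))).exists
  obtain ⟨m, rfl⟩ := exists_eq_of_tendsto_frequency hs'.ne' h'
  obtain ⟨n, rfl⟩ := exists_eq_of_tendsto_frequency hs''.ne' h''
  exact hreach (SimpleGraph.reachable_of_forall_eq_or_adj (x := (X · ω)) hω m n)
end

section
/- Let μ be a probability distribution on S such that G[supp μ] is not connected and supp μ is contained in a single connected component of G. Then no time-homogeneous Markov chain X = (X(t) : t ∈ ℕ) on S that is consistent with G satisfies, for every s ∈ S, lim_{t→∞} (1/t) Σ_{m=0}^{t−1} 1_{{X(m)=s}} = μ(s) almost surely. -/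
open Finset Filter MeasureTheory

attribute [local instance] Classical.propDecidable

lemma measureReal_path_succ {Ω S : Type*} [MeasurableSpace Ω] {P : Measure Ω}
    {X : ℕ → Ω → S} {Q : Matrix S S ℝ} (hM : IsMarkovOn P X fun _ => Q) (n : ℕ) (path : ℕ → S) :
    P.real {ω | ∀ i ≤ n + 1, X i ω = path i} =
      P.real {ω | ∀ i ≤ n, X i ω = path i} * Q (path n) (path (n + 1)) := by
  have h := hM n path
  rw [Finset.prod_range_succ, ← mul_assoc] at h
  refine h.trans (congrArg (· * _) ?_)
  cases n with
  | zero => simp [Measure.real]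
  | succ k => exact (hM k path).symm

/-- If the empirical frequencies converge almost surely, so do the Cesàro means of the
marginals. -/
lemma tendsto_cesaro_measureReal {Ω S : Type*} [MeasurableSpace Ω] {P : Measure Ω}
    [IsProbabilityMeasure P] [MeasurableSpace S] [MeasurableSingletonClass S] [DecidableEq S]
    {X : ℕ → Ω → S} (hX : ∀ t, Measurable (X t)) {s : S} {c : ℝ}
    (h : ∀ᵐ ω ∂P, Tendsto
      (fun t : ℕ => (∑ m ∈ Finset.range t, if X m ω = s then (1 : ℝ) else 0) / t)
      atTop (nhds c)) :
    Tendsto (fun t : ℕ => (∑ m ∈ Finset.range t, P.real {ω | X m ω = s}) / t)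
      atTop (nhds c) := by
  have hms (m : ℕ) : MeasurableSet {ω | X m ω = s} := hX m (measurableSet_singleton s)
  have hmeas (m : ℕ) : Measurable fun ω => if X m ω = s then (1 : ℝ) else 0 :=
    Measurable.ite (hms m) measurable_const measurable_const
  have hint (m : ℕ) : ∫ ω, (if X m ω = s then (1 : ℝ) else 0) ∂P = P.real {ω | X m ω = s} := by
    rw [← integral_indicator_one (hms m)]
    simp [Set.indicator_apply]
  have hlim := tendsto_integral_of_dominated_convergence
    (μ := P) (fun _ => (1 : ℝ))
    (fun t : ℕ => ((Finset.measurable_sum (Finset.range t) fun m _ => hmeas m).div_const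
      (t : ℝ)).aestronglyMeasurable)
    (integrable_const 1) (fun t => ae_of_all _ fun ω => ?_) h
  · rw [integral_const, probReal_univ, one_smul] at hlim
    refine hlim.congr fun t => ?_
    rw [integral_div, integral_finsetSum]
    · simp_rw [hint]
    · exact fun m _ => Integrable.of_bound (hmeas m).aestronglyMeasurable 1
        (ae_of_all _ fun ω => by split_ifs <;> simp)
  · rw [Real.norm_of_nonneg (by positivity)]
    refine div_le_one_of_le₀ ?_ (by positivity)
    refine (Finset.sum_le_card_nsmul _ _ 1 fun m _ => ?_).trans (by simp)
    split_ifs <;> norm_num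

section MarkovChain

variable {Ω S : Type*} [MeasurableSpace Ω] {P : Measure Ω} [IsProbabilityMeasure P]
  [Fintype S] [MeasurableSpace S] [MeasurableSingletonClass S]
  {X : ℕ → Ω → S} {Q : Matrix S S ℝ}

/-- Law of total probability over the values of a random variable on a finite type. -/
lemma sum_measureReal_fiber_inter {Y : Ω → S} (hY : Measurable Y) (B : Set Ω) :
    ∑ s, P.real ({ω | Y ω = s} ∩ B) = P.real B := by
  have h := sum_measureReal_preimage_singleton (μ := P.restrict B) (f := Y) Finset.univ
    (fun y _ => hY (measurableSet_singleton y))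
  rw [Finset.coe_univ, Set.preimage_univ, measureReal_restrict_apply_univ] at h
  rw [← h]
  refine Finset.sum_congr rfl fun s _ => ?_
  rw [measureReal_restrict_apply (hY (measurableSet_singleton s))]
  rfl

/-- The two-step marginals of a time-homogeneous Markov chain. -/
lemma measureReal_transition (hX : ∀ t, Measurable (X t)) (hM : IsMarkovOn P X fun _ => Q)
    (n : ℕ) (s s' : S) :
    P.real {ω | X n ω = s ∧ X (n + 1) ω = s'} = P.real {ω | X n ω = s} * Q s s' := by
  have hY : Measurable fun ω (i : Fin (n + 1)) => X i ω := measurable_pi_lambda _ fun i => hX i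
  rw [← sum_measureReal_fiber_inter hY, ← sum_measureReal_fiber_inter hY {ω | X n ω = s},
    Finset.sum_mul]
  refine Finset.sum_congr rfl fun f _ => ?_
  by_cases hf : f (Fin.last n) = s
  · let path : ℕ → S := fun i => if h : i < n + 1 then f ⟨i, h⟩ else s'
    have hlt (i : ℕ) (h : i < n + 1) : path i = f ⟨i, h⟩ := dif_pos h
    have hn : path n = s := (hlt n n.lt_succ_self).trans hf
    have hn' : path (n + 1) = s' := dif_neg (lt_irrefl _)
    have hprefix (ω : Ω) :
        (fun i : Fin (n + 1) => X i ω) = f ↔ ∀ i ≤ n, X i ω = path i := by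
      rw [funext_iff, Fin.forall_iff]
      refine forall_congr' fun i => ⟨fun h hi => ?_, fun h hi => ?_⟩
      · rw [hlt i (Nat.lt_succ_of_le hi)]; exact h _
      · rw [h (Nat.le_of_lt_succ hi), hlt i hi]
    have h := measureReal_path_succ hM n path
    rw [hn, hn'] at h
    convert h using 2
    · ext ω
      simp only [Set.mem_inter_iff, Set.mem_ofPred_eq, hprefix]
      constructor
      · rintro ⟨h, -, h'⟩ i hi
        rcases Nat.le_succ_iff.mp hi with hi | rfl
        · exact h i hi
        · rw [h', hn']
      · exact fun h => ⟨fun i hi => h i (hi.trans n.le_succ), (h n n.le_succ).trans hn,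
          (h _ le_rfl).trans hn'⟩
    · congr 1
      ext ω
      simp only [Set.mem_inter_iff, Set.mem_ofPred_eq, hprefix, and_iff_left_iff_imp]
      exact fun h => (h n le_rfl).trans hn
  · have h₁ : {ω | (fun i : Fin (n + 1) => X i ω) = f} ∩ {ω | X n ω = s} = ∅ := by
      ext ω
      simp only [Set.mem_inter_iff, Set.mem_ofPred_eq, Set.mem_empty_iff_false, iff_false]
      rintro ⟨rfl, h⟩
      exact hf h
    have h₂ : {ω | (fun i : Fin (n + 1) => X i ω) = f} ∩
        {ω | X n ω = s ∧ X (n + 1) ω = s'} = ∅ :=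
      Set.subset_eq_empty (Set.inter_subset_inter_right _ fun _ h => h.1) h₁
    simp [h₁, h₂]

lemma measureReal_succ (hX : ∀ t, Measurable (X t)) (hM : IsMarkovOn P X fun _ => Q)
    (n : ℕ) (r : S) :
    P.real {ω | X (n + 1) ω = r} = ∑ s, P.real {ω | X n ω = s} * Q s r := by
  rw [← sum_measureReal_fiber_inter (hX n)]
  exact Finset.sum_congr rfl fun s _ => measureReal_transition hX hM n s r

/-- Almost surely, a Markov chain only makes transitions of nonzero probability. -/
lemma ae_transition_ne_zero (hX : ∀ t, Measurable (X t)) (hM : IsMarkovOn P X fun _ => Q) :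
    ∀ᵐ ω ∂P, ∀ n, Q (X n ω) (X (n + 1) ω) ≠ 0 := by
  have h : ∀ᵐ ω ∂P, ∀ (n : ℕ) (s s' : S), Q s s' = 0 → ¬ (X n ω = s ∧ X (n + 1) ω = s') := by
    simp only [ae_all_iff]
    intro n s s' hQ
    have h := measureReal_transition hX hM n s s'
    rw [hQ, mul_zero, measureReal_eq_zero_iff] at h
    exact measure_eq_zero_iff_ae_notMem.mp h
  filter_upwards [h] with ω hω n hQ
  exact hω n _ _ hQ ⟨rfl, rfl⟩

/-- The almost sure limit of the empirical frequencies of a Markov chain is stationary. -/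
lemma stationary_of_ae_tendsto [DecidableEq S] (hX : ∀ t, Measurable (X t))
    (hM : IsMarkovOn P X fun _ => Q) {μ : S → ℝ}
    (h : ∀ s, ∀ᵐ ω ∂P, Tendsto
      (fun t : ℕ => (∑ m ∈ Finset.range t, if X m ω = s then (1 : ℝ) else 0) / t)
      atTop (nhds (μ s))) (s' : S) :
    ∑ s, μ s * Q s s' = μ s' := by
  have hC (s : S) := tendsto_cesaro_measureReal hX (h s)
  have h₁ := tendsto_finsetSum Finset.univ fun s _ => (hC s).mul_const (Q s s')
  refine tendsto_nhds_unique h₁ ?_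
  set p : ℕ → ℝ := fun m => P.real {ω | X m ω = s'}
  have hzero : Tendsto (fun t : ℕ => (p t - p 0) / t) atTop (nhds 0) := by
    refine squeeze_zero_norm (fun t => ?_) tendsto_one_div_atTop_nhds_zero_nat
    rw [norm_div, RCLike.norm_natCast, Real.norm_eq_abs]
    gcongr
    have := measureReal_nonneg (μ := P) (s := {ω | X t ω = s'})
    have := measureReal_nonneg (μ := P) (s := {ω | X 0 ω = s'})
    have := measureReal_le_one (μ := P) (s := {ω | X t ω = s'})
    have := measureReal_le_one (μ := P) (s := {ω | X 0 ω = s'})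
    rw [abs_le]
    constructor <;> linarith
  have hsum := (hC s').add hzero
  rw [add_zero] at hsum
  refine hsum.congr fun t => ?_
  simp_rw [div_mul_eq_mul_div, ← Finset.sum_div, Finset.sum_mul]
  rw [Finset.sum_comm, ← add_div]
  simp_rw [← measureReal_succ hX hM]
  rw [← Finset.sum_range_sub p t, ← Finset.sum_add_distrib]
  simp [p]

end MarkovChain

/-- The frequency of a value that is eventually never taken tends to zero. -/
lemma tendsto_frequency_zero {S : Type*} [DecidableEq S] {x : ℕ → S} {v : S} {m : ℕ}
    (h : ∀ n, m ≤ n → x n ≠ v) :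
    Tendsto (fun t : ℕ => (∑ n ∈ Finset.range t, if x n = v then (1 : ℝ) else 0) / t)
      atTop (nhds 0) := by
  refine (tendsto_const_div_atTop_nhds_zero_nat
    (∑ n ∈ Finset.range m, if x n = v then (1 : ℝ) else 0)).congr' ?_
  filter_upwards [eventually_ge_atTop m] with t ht
  congr 1
  refine Finset.sum_subset (Finset.range_subset_range.mpr ht) fun n _ hn => ?_
  exact if_neg (h n (by simpa using hn))

theorem stmt_14 {N : ℕ} (G : SimpleGraph (Fin N))
    (μ : Fin N → ℝ) (hμ0 : ∀ s, 0 ≤ μ s) (hμ1 : ∑ s, μ s = 1)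
    (hsupp : ¬ (G.induce {s : Fin N | 0 < μ s}).Connected)
    (hone : ∀ s' s'' : Fin N, 0 < μ s' → 0 < μ s'' → G.Reachable s' s'')
    {Ω : Type*} [MeasurableSpace Ω] (P : Measure Ω) [IsProbabilityMeasure P]
    (X : ℕ → Ω → Fin N) (hX : ∀ t, Measurable (X t))
    (Q : Matrix (Fin N) (Fin N) ℝ)
    (hQ0 : ∀ l m, 0 ≤ Q l m) (hQ1 : ∀ l, ∑ m, Q l m = 1)
    (hMarkov : IsMarkovOn P X fun _ => Q)
    (hcons : ConsistentWith P X G) :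
    ¬ ∀ s : Fin N, ∀ᵐ ω ∂P,
      Tendsto (fun t : ℕ => (∑ m ∈ Finset.range t, if X m ω = s then (1 : ℝ) else 0) / t)
        atTop (nhds (μ s)) := by
  intro hlim
  have hne : Nonempty {s : Fin N | 0 < μ s} := by
    obtain ⟨s, -, hs⟩ := Finset.exists_lt_of_sum_lt
      (show ∑ _s : Fin N, (0 : ℝ) < ∑ s, μ s by rw [hμ1]; simp)
    exact ⟨s, hs⟩
  obtain ⟨u, v, huv⟩ : ∃ u v, ¬ (G.induce {s : Fin N | 0 < μ s}).Reachable u v := by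
    by_contra! h
    exact hsupp ⟨h⟩
  have hstat := stationary_of_ae_tendsto hX hMarkov hlim
  have hadj : ∀ᵐ ω ∂P, ∀ t, X t ω = X (t + 1) ω ∨ G.Adj (X t ω) (X (t + 1) ω) := by
    refine ae_all_iff.mpr fun t => ?_
    refine (mem_ae_iff_prob_eq_one ?_).mpr (hcons t)
    exact ((hX t).prodMk (hX (t + 1))) (Set.toFinite
      {p : Fin N × Fin N | p.1 = p.2 ∨ G.Adj p.1 p.2}).measurableSet
  obtain ⟨ω, hω, hωadj, hωQ⟩ :=
    ((ae_all_iff.mpr hlim).and (hadj.and (ae_transition_ne_zero hX hMarkov))).exists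
  obtain ⟨m, hm⟩ : ∃ m, X m ω = u := by
    by_contra! h
    exact u.2.ne (tendsto_nhds_unique (tendsto_frequency_zero fun n (_ : 0 ≤ n) => h n) (hω u))
  have hclosed (n : ℕ) (hn : m ≤ n) :
      ∃ h : 0 < μ (X n ω), (G.induce {s : Fin N | 0 < μ s}).Reachable u ⟨X n ω, h⟩ := by
    induction n, hn using Nat.le_induction with
    | base => exact ⟨hm ▸ u.2, by simp only [hm]; rfl⟩
    | succ n _ ih =>
      obtain ⟨hpos, hreach⟩ := ih
      have hpos' : 0 < μ (X (n + 1) ω) := by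
        rw [← hstat]
        refine (mul_pos hpos ((hQ0 _ _).lt_of_ne' (hωQ n))).trans_le ?_
        exact Finset.single_le_sum (f := fun s => μ s * Q s (X (n + 1) ω))
          (fun s _ => mul_nonneg (hμ0 s) (hQ0 _ _)) (Finset.mem_univ _)
      refine ⟨hpos', ?_⟩
      rcases hωadj n with h | h
      · simpa only [← h] using hreach
      · exact hreach.trans (SimpleGraph.Adj.reachable (by simpa using h))
  refine v.2.ne (tendsto_nhds_unique (tendsto_frequency_zero fun n (hn : m ≤ n) h => huv ?_) (hω v))
  obtain ⟨hpos, hreach⟩ := hclosed n hn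
  simpa only [h] using hreach
end
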